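/- Let σ be a behavioral strategy profile of a finite extensive-form game. For each node h ∈ H, let k(h) be the number of edges on the path from the root to h that carry probability zero (probability σ_{V(h')}(a|I(h')) for a player edge (h', h'a) and P(x|h') for a chance edge (h', h'x)). Then: (1) the total preorder on H defined by h ≾ h' iff k(h) ≤ k(h') is a plausibility order; (2) for every decision node h and action a available at h, the strategy assigns positive probability to a at I(h) iff k(ha) = k(h), and for every chance node h and outcome x ∈ X(h), P(x|h) > 0 iff k(hx) = k(h); (3) for every node h, r(h, σ) > 0 iff k(h) = 0. -/

import Mathlib

noncomputable section

open Finset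

/-- A finite extensive-form game; nodes are histories (lists of edge labels).
The tree `H` is the finite, prefix-closed set `nodes`; the child of `h` via
edge-label `a` is `h ++ [a]`; a node is terminal iff its label set is empty. -/
structure EFG (Act : Type) [DecidableEq Act] where
  /-- the set `H` of histories/nodes of the game tree -/
  nodes : Finset (List Act)
  root_mem : ([] : List Act) ∈ nodes
  prefix_closed : ∀ (h : List Act) (a : Act), h ++ [a] ∈ nodes → h ∈ nodes
  /-- `V`, the acting player at a node (`0` is chance) -/
  player : List Act → ℕ
  /-- labels of the outgoing edges of a node (actions, resp. chance outcomes) -/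
  actions : List Act → Finset Act
  child_mem : ∀ h ∈ nodes, ∀ a ∈ actions h, h ++ [a] ∈ nodes
  mem_actions_of_child : ∀ h ∈ nodes, ∀ a : Act, h ++ [a] ∈ nodes → a ∈ actions h
  /-- `P(·|h)`: the chance distribution at chance nodes -/
  chance : List Act → Act → ℝ
  chance_pos : ∀ h ∈ nodes, actions h ≠ ∅ → player h = 0 → ∀ x ∈ actions h, 0 < chance h x
  chance_sums : ∀ h ∈ nodes, actions h ≠ ∅ → player h = 0 → ∑ a ∈ actions h, chance h a = 1
  /-- `I(h)`: the information set containing a (player) decision node -/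
  infoClass : List Act → Finset (List Act)
  mem_infoClass : ∀ h ∈ nodes, actions h ≠ ∅ → player h ≠ 0 → h ∈ infoClass h
  infoClass_spec : ∀ h ∈ nodes, actions h ≠ ∅ → player h ≠ 0 →
    ∀ h' ∈ infoClass h, h' ∈ nodes ∧ actions h' = actions h ∧ player h' = player h ∧
      infoClass h' = infoClass h
  /-- `u j z`: the utility of player `j` at terminal node `z` -/
  util : ℕ → List Act → ℝ

namespace EFG

variable {Act : Type} [DecidableEq Act]

/-- the set `Z` of terminal nodes -/
def terminals (G : EFG Act) : Finset (List Act) :=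
  G.nodes.filter fun z => G.actions z = ∅

/-- `I` is an information set of player `j` (i.e. `I ∈ I_j`) -/
def IsInfoset (G : EFG Act) (j : ℕ) (I : Finset (List Act)) : Prop :=
  ∃ h ∈ G.nodes, G.actions h ≠ ∅ ∧ G.player h = j ∧ G.infoClass h = I

/-- A behavioral strategy profile (it also records the chance probabilities,
so that `prob h a` is the probability of the edge `(h, h ++ [a])` for every node). -/
structure Strategy (G : EFG Act) where
  prob : List Act → Act → ℝ
  nonneg : ∀ h a, 0 ≤ prob h a
  sums_one : ∀ h ∈ G.nodes, G.actions h ≠ ∅ → ∑ a ∈ G.actions h, prob h a = 1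
  measurable : ∀ h ∈ G.nodes, G.actions h ≠ ∅ → G.player h ≠ 0 →
    ∀ h' ∈ G.infoClass h, prob h' = prob h
  chance_eq : ∀ h ∈ G.nodes, G.actions h ≠ ∅ → G.player h = 0 →
    ∀ a : Act, prob h a = G.chance h a

/-- the profile `σ` plays a pure strategy for player `j` -/
def IsPureFor (G : EFG Act) (σ : G.Strategy) (j : ℕ) : Prop :=
  ∀ h ∈ G.nodes, G.actions h ≠ ∅ → G.player h = j → ∃ a ∈ G.actions h, σ.prob h a = 1

/-- `τ = (τ_j, σ_{-j})`: `τ` agrees with `σ` at all decision nodes of players other than `j` -/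
def AgreesOff (G : EFG Act) (σ τ : G.Strategy) (j : ℕ) : Prop :=
  ∀ h ∈ G.nodes, G.actions h ≠ ∅ → G.player h ≠ j → τ.prob h = σ.prob h

/-- `σ' = σ|_{I → a}`: the profile equal to `σ` except that at `I` action `a`
is played with probability 1 -/
def IsDeviationAt (G : EFG Act) (σ σ' : G.Strategy) (I : Finset (List Act)) (a : Act) : Prop :=
  ∀ (h : List Act) (b : Act),
    σ'.prob h b = if h ∈ I then (if b = a then 1 else 0) else σ.prob h b

/-- a system of beliefs: a probability distribution over each information set -/
structure Belief (G : EFG Act) where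
  prob : List Act → ℝ
  nonneg : ∀ h, 0 ≤ prob h
  sums_one : ∀ h ∈ G.nodes, G.actions h ≠ ∅ → G.player h ≠ 0 →
    ∑ h' ∈ G.infoClass h, prob h' = 1

/-- product of edge probabilities along the path from `h` through the extension `s` -/
def suffixProb (G : EFG Act) (σ : G.Strategy) : List Act → List Act → ℝ
  | _, [] => 1
  | h, a :: s => σ.prob h a * suffixProb G σ (h ++ [a]) s

/-- reach probability `r(h, σ)` of a node from the root -/
def reach (G : EFG Act) (σ : G.Strategy) (h : List Act) : ℝ :=
  G.suffixProb σ [] h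

/-- conditional reach probability `r(h'|h,σ)` (zero if `h'` is not a successor of `h`) -/
def condReach (G : EFG Act) (σ : G.Strategy) (h h' : List Act) : ℝ :=
  if h <+: h' then G.suffixProb σ h (h'.drop h.length) else 0

/-- `Z ∩ Succ(h)`: terminal successors of `h` (including `h` itself if it is terminal) -/
def termSucc (G : EFG Act) (h : List Act) : Finset (List Act) :=
  G.nodes.filter fun z => G.actions z = ∅ ∧ h <+: z

/-- conditional expected utility `U^E(σ|h)` w.r.t. the terminal utility function `u` -/
def expUtil (G : EFG Act) (u : List Act → ℝ) (σ : G.Strategy) (h : List Act) : ℝ :=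
  ∑ z ∈ G.termSucc h, u z * G.condReach σ h z

/-- believed utility `U^B(σ, μ | I)` w.r.t. the terminal utility function `u` -/
def belUtil (G : EFG Act) (u : List Act → ℝ) (σ : G.Strategy) (μ : G.Belief)
    (I : Finset (List Act)) : ℝ :=
  ∑ h ∈ I, μ.prob h * G.expUtil u σ h

/-- `r^{σ,μ}(h'|I) = Σ_{h ∈ I} μ(h|I) r(h'|h,σ)` -/
def belReachNode (G : EFG Act) (σ : G.Strategy) (μ : G.Belief)
    (I : Finset (List Act)) (h' : List Act) : ℝ :=
  ∑ h ∈ I, μ.prob h * G.condReach σ h h'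

/-- `r^{σ,μ}(I'|I) = Σ_{h' ∈ I'} r^{σ,μ}(h'|I)` -/
def belReachSet (G : EFG Act) (σ : G.Strategy) (μ : G.Belief)
    (I I' : Finset (List Act)) : ℝ :=
  ∑ h' ∈ I', G.belReachNode σ μ I h'

/-- the information set `I'` (strictly) succeeds the information set `I` -/
def Succeeds (G : EFG Act) (I I' : Finset (List Act)) : Prop :=
  ∃ h ∈ I, ∃ h' ∈ I', h <+: h' ∧ h ≠ h'

/-- consistency of an assessment `(σ, μ)` in the sense of Hendon et al. -/
def Consistent (G : EFG Act) (σ : G.Strategy) (μ : G.Belief) : Prop :=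
  ∀ j : ℕ, 1 ≤ j → ∀ I I' : Finset (List Act),
    G.IsInfoset j I → G.IsInfoset j I' → G.Succeeds I I' →
    ∀ z ∈ G.nodes, G.actions z = ∅ → (∃ h' ∈ I', h' <+: z ∧ h' ≠ z) →
      G.belReachNode σ μ I z = G.belReachNode σ μ I' z * G.belReachSet σ μ I I'

/-- the sequence of (information set, action) pairs of player `j` along a history -/
def recordAux (G : EFG Act) (j : ℕ) : List Act → List Act → List (Finset (List Act) × Act)
  | _, [] => []
  | h, a :: s =>
      (if G.player h = j then [(G.infoClass h, a)] else []) ++ recordAux G j (h ++ [a]) s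

/-- perfect recall: any two nodes in the same information set of a player have the
same record of that player's past information sets and chosen actions -/
def PerfectRecall (G : EFG Act) : Prop :=
  ∀ h ∈ G.nodes, G.actions h ≠ ∅ → G.player h ≠ 0 →
    ∀ h' ∈ G.infoClass h,
      G.recordAux (G.player h) [] h = G.recordAux (G.player h) [] h'

/-- a plausibility order: a total preorder on the nodes satisfying the three
structural conditions of Bonanno -/
structure PlausOrder (G : EFG Act) where
  le : List Act → List Act → Prop
  refl : ∀ h, le h h
  trans : ∀ h₁ h₂ h₃, le h₁ h₂ → le h₂ h₃ → le h₁ h₃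
  total : ∀ h ∈ G.nodes, ∀ h' ∈ G.nodes, le h h' ∨ le h' h
  /-- (i) it is never the case that `ha ≺ h` -/
  child_not_lt : ∀ h ∈ G.nodes, G.actions h ≠ ∅ → ∀ a ∈ G.actions h,
    le (h ++ [a]) h → le h (h ++ [a])
  /-- (ii) every decision node has at least one action `a` with `ha ≾ h` … -/
  exists_le : ∀ h ∈ G.nodes, G.actions h ≠ ∅ → ∃ a ∈ G.actions h, le (h ++ [a]) h
  /-- … and any such `a` satisfies `h'a ≾ h'` for all `h'` in the information set of `h` -/
  info_le : ∀ h ∈ G.nodes, G.actions h ≠ ∅ → G.player h ≠ 0 → ∀ a ∈ G.actions h,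
    le (h ++ [a]) h → ∀ h' ∈ G.infoClass h, le (h' ++ [a]) h'
  /-- (iii) for every chance node `h` and outcome `x`, `hx ≾ h` -/
  chance_le : ∀ h ∈ G.nodes, G.actions h ≠ ∅ → G.player h = 0 → ∀ x ∈ G.actions h,
    le (h ++ [x]) h

/-- the plausibility order `P` rationalizes the assessment `(σ, μ)` (AGM-consistency) -/
def Rationalizes (G : EFG Act) (P : G.PlausOrder) (σ : G.Strategy) (μ : G.Belief) : Prop :=
  (∀ h ∈ G.nodes, G.actions h ≠ ∅ → G.player h ≠ 0 → ∀ a ∈ G.actions h,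
    (0 < σ.prob h a ↔ (P.le h (h ++ [a]) ∧ P.le (h ++ [a]) h))) ∧
  (∀ h ∈ G.nodes, G.actions h ≠ ∅ → G.player h = 0 → ∀ x ∈ G.actions h,
    (0 < G.chance h x ↔ (P.le h (h ++ [x]) ∧ P.le (h ++ [x]) h))) ∧
  (∀ h ∈ G.nodes, G.actions h ≠ ∅ → G.player h ≠ 0 →
    (0 < μ.prob h ↔ ∀ h' ∈ G.infoClass h, P.le h h'))

open Classical in
/-- number of probability-zero edges along the path from `h` through the extension `s` -/
def zeroCountAux (G : EFG Act) (σ : G.Strategy) : List Act → List Act → ℕ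
  | _, [] => 0
  | h, a :: s =>
      (if σ.prob h a = 0 then 1 else 0) + zeroCountAux G σ (h ++ [a]) s

/-- `k(h)`: the number of probability-zero edges on the path from the root to `h` -/
def zeroCount (G : EFG Act) (σ : G.Strategy) (h : List Act) : ℕ :=
  G.zeroCountAux σ [] h

end EFG

namespace EFG

variable {Act : Type} [DecidableEq Act]

open Classical in
theorem zeroCountAux_append_singleton (G : EFG Act) (σ : G.Strategy) (h s : List Act) (a : Act) :
    G.zeroCountAux σ h (s ++ [a]) =
      G.zeroCountAux σ h s + if σ.prob (h ++ s) a = 0 then 1 else 0 := by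
  induction s generalizing h with
  | nil => simp [zeroCountAux]
  | cons b s ih => simp [zeroCountAux, ih, add_assoc]

open Classical in
theorem zeroCount_append_singleton (G : EFG Act) (σ : G.Strategy) (h : List Act) (a : Act) :
    G.zeroCount σ (h ++ [a]) = G.zeroCount σ h + if σ.prob h a = 0 then 1 else 0 := by
  simpa [zeroCount] using G.zeroCountAux_append_singleton σ [] h a

theorem prob_pos_iff_ne_zero (G : EFG Act) (σ : G.Strategy) (h : List Act) (a : Act) :
    0 < σ.prob h a ↔ σ.prob h a ≠ 0 :=
  (σ.nonneg h a).lt_iff_ne'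

theorem zeroCount_le_zeroCount_append_singleton (G : EFG Act) (σ : G.Strategy) (h : List Act)
    (a : Act) : G.zeroCount σ h ≤ G.zeroCount σ (h ++ [a]) := by
  rw [zeroCount_append_singleton]
  exact Nat.le_add_right _ _

theorem zeroCount_append_singleton_eq_iff (G : EFG Act) (σ : G.Strategy) (h : List Act)
    (a : Act) : G.zeroCount σ (h ++ [a]) = G.zeroCount σ h ↔ 0 < σ.prob h a := by
  rw [zeroCount_append_singleton, prob_pos_iff_ne_zero]
  simp

theorem zeroCount_append_singleton_le_iff (G : EFG Act) (σ : G.Strategy) (h : List Act)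
    (a : Act) : G.zeroCount σ (h ++ [a]) ≤ G.zeroCount σ h ↔ 0 < σ.prob h a := by
  rw [← zeroCount_append_singleton_eq_iff]
  exact (G.zeroCount_le_zeroCount_append_singleton σ h a).ge_iff_eq'

theorem Strategy.exists_prob_pos {G : EFG Act} (σ : G.Strategy) {h : List Act}
    (hh : h ∈ G.nodes) (hA : G.actions h ≠ ∅) : ∃ a ∈ G.actions h, 0 < σ.prob h a := by
  have hsum : 0 < ∑ a ∈ G.actions h, σ.prob h a := by
    rw [σ.sums_one h hh hA]
    exact one_pos
  exact (Finset.sum_pos_iff_of_nonneg fun a _ => σ.nonneg h a).mp hsum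

theorem suffixProb_pos_iff (G : EFG Act) (σ : G.Strategy) (h s : List Act) :
    0 < G.suffixProb σ h s ↔ G.zeroCountAux σ h s = 0 := by
  induction s generalizing h with
  | nil => simp [suffixProb, zeroCountAux]
  | cons a s ih =>
    rcases (σ.nonneg h a).eq_or_lt with h0 | h0
    · simp [suffixProb, zeroCountAux, ← h0]
    · simp [suffixProb, zeroCountAux, h0, h0.ne', ih]

/-- The plausibility order ranking nodes by their number of probability-zero edges. -/
def zeroCountOrder (G : EFG Act) (σ : G.Strategy) : G.PlausOrder where
  le h h' := G.zeroCount σ h ≤ G.zeroCount σ h'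
  refl _ := le_rfl
  trans _ _ _ := le_trans
  total _ _ _ _ := le_total _ _
  child_not_lt h _ _ a _ _ := G.zeroCount_le_zeroCount_append_singleton σ h a
  exists_le h hh hA := by
    simpa only [zeroCount_append_singleton_le_iff] using σ.exists_prob_pos hh hA
  info_le h hh hA hp a _ hle h' hh' := by
    rw [zeroCount_append_singleton_le_iff] at hle ⊢
    rwa [σ.measurable h hh hA hp h' hh']
  chance_le h hh hA hp x hx := by
    rw [zeroCount_append_singleton_le_iff, σ.chance_eq h hh hA hp]
    exact G.chance_pos h hh hA hp x hx

end EFG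

/-- Counting the probability-zero edges `k(h)` on the path from
the root to each node yields (1) a plausibility order (`h ≾ h'` iff `k(h) ≤ k(h')`);
moreover (2) an action (resp. chance outcome) at a decision node has positive
probability iff it preserves `k`; and (3) a node is reachable under `σ` iff
`k(h) = 0`. -/
theorem zeroCount_plausibility_order
    {Act : Type} [DecidableEq Act] (G : EFG Act) (σ : G.Strategy) :
    (∃ P : G.PlausOrder, ∀ h h' : List Act,
        P.le h h' ↔ G.zeroCount σ h ≤ G.zeroCount σ h') ∧
    (∀ h ∈ G.nodes, G.actions h ≠ ∅ →
      (G.player h ≠ 0 → ∀ a ∈ G.actions h,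
        (0 < σ.prob h a ↔ G.zeroCount σ (h ++ [a]) = G.zeroCount σ h)) ∧
      (G.player h = 0 → ∀ x ∈ G.actions h,
        (0 < G.chance h x ↔ G.zeroCount σ (h ++ [x]) = G.zeroCount σ h))) ∧
    (∀ h ∈ G.nodes, (0 < G.reach σ h ↔ G.zeroCount σ h = 0)) := by
  refine ⟨⟨G.zeroCountOrder σ, fun _ _ => Iff.rfl⟩, fun h hh hA => ⟨fun _ a _ => ?_,
    fun hp x _ => ?_⟩, fun h _ => G.suffixProb_pos_iff σ [] h⟩
  · exact (G.zeroCount_append_singleton_eq_iff σ h a).symm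
  · rw [← σ.chance_eq h hh hA hp x]
    exact (G.zeroCount_append_singleton_eq_iff σ h x).symm
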